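/- Fix n ≥ 1 and k ≥ 1, and define L_m(x_1,…,x_k) := Σ_{μ ∈ wcomp_m, supp(μ) ⊆ [k]} |Lyn_μ| x^μ with L_ν := L_{ν_1} ⋯ L_{ν_r} for a partition ν. Then the n × n matrices over ℚ[x_1,…,x_k] given by A = [ (−1)^{i−j} Σ_{λ ⊢ i, ℓ(λ)=j} (i choose λ) (1/m(λ)!) L_{λ∖(1^j)}(x_1,…,x_k) ]_{0 ≤ i,j ≤ n−1} and B = [ Σ_{λ ⊢ i, ℓ(λ)=j} (i choose λ) (1/m(λ)!) h_{λ∖(1^j)}(x_1,…,x_k) ]_{0 ≤ i,j ≤ n−1} are inverses of each other. -/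

import Mathlib

/-! Colored labeled binary trees.  Leaf labels are positive integers; colors are
natural numbers (the paper's color set ℙ = {1,2,…} is identified with ℕ via j ↦ j-1,
i.e. color index `i : ℕ` represents the paper's color `i+1`). -/

inductive CTree : Type
  | leaf (label : ℕ) : CTree
  | node (color : ℕ) (l r : CTree) : CTree
deriving DecidableEq

namespace CTree

/-- leaf labels from left to right -/
def leavesList : CTree → List ℕ
  | leaf m => [m]
  | node _ l r => leavesList l ++ leavesList r

/-- the valency `v(x)`: smallest leaf label of the subtree -/
def minLeaf : CTree → ℕ
  | leaf m => m
  | node _ l r => min (minLeaf l) (minLeaf r)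

/-- a tree is normalized if in every subtree the leftmost leaf carries the
smallest leaf label of the subtree. -/
def Normalized : CTree → Prop
  | leaf _ => True
  | node _ l r => Normalized l ∧ Normalized r ∧ minLeaf l < minLeaf r

/-- number of internal nodes with color `j` -/
def colorCount : CTree → ℕ → ℕ
  | leaf _, _ => 0
  | node c l r, j => (if c = j then 1 else 0) + colorCount l j + colorCount r j

def isLeafB : CTree → Bool
  | leaf _ => true
  | node _ _ _ => false

def left : CTree → CTree
  | leaf m => leaf m
  | node _ l _ => l

def right : CTree → CTree
  | leaf m => leaf m
  | node _ _ r => r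

def rootColor : CTree → ℕ
  | leaf _ => 0
  | node c _ _ => c

/-- the root of `T` is a Lyndon node: either the left child is a leaf
or `v(R(L(x))) > v(R(x))`. (Leaves count as Lyndon.) -/
def RootLyndonB (T : CTree) : Bool :=
  isLeafB T || isLeafB (left T) || decide (minLeaf (right T) < minLeaf (right (left T)))

/-- colored Lyndon condition: every internal node that is not a Lyndon node
satisfies `color(L(x)) > color(x)` -/
def LynColored : CTree → Prop
  | leaf _ => True
  | node c l r => LynColored l ∧ LynColored r ∧
      (RootLyndonB (node c l r) = true ∨ c < rootColor l)

/-- colored comb condition: every internal node whose right child is internal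
satisfies `color(x) > color(R(x))` -/
def CombColored : CTree → Prop
  | leaf _ => True
  | node c l r => CombColored l ∧ CombColored r ∧ (isLeafB r = true ∨ rootColor r < c)

/-- all colors equal to `0`: an (essentially) uncolored tree. -/
def Mono : CTree → Prop
  | leaf _ => True
  | node c l r => c = 0 ∧ Mono l ∧ Mono r

/-- the tree has leaf label set `[n] = {1,…,n}` (each label once) -/
def OnSet (n : ℕ) (T : CTree) : Prop := T.leavesList.Perm ((List.range n).map (· + 1))

/-- `lynAux T = (b, m)`: `b` is the size of the block of `π^{Lyn}` containing the
root (`0` for a leaf) and `m` is the multiset of sizes of the other blocks. -/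
def lynAux : CTree → ℕ × Multiset ℕ
  | leaf _ => (0, 0)
  | node c l r =>
    let bl := (lynAux l).1
    let ml := (lynAux l).2
    let br := (lynAux r).1
    let mr := (lynAux r).2
    let closedR := mr + (if br = 0 then 0 else {br})
    if RootLyndonB (node c l r) then
      (1, ml + (if bl = 0 then 0 else {bl}) + closedR)
    else (1 + bl, ml + closedR)

/-- the Lyndon type `λ^{Lyn}`: multiset of block sizes of `π^{Lyn}` -/
def lynType (T : CTree) : Multiset ℕ :=
  (if (lynAux T).1 = 0 then (0 : Multiset ℕ) else {(lynAux T).1}) + (lynAux T).2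

def combAux : CTree → ℕ × Multiset ℕ
  | leaf _ => (0, 0)
  | node _ l r =>
    let bl := (combAux l).1
    let ml := (combAux l).2
    let br := (combAux r).1
    let mr := (combAux r).2
    (1 + br, ml + mr + (if bl = 0 then 0 else {bl}))

/-- the comb type `λ^{Comb}`: multiset of block sizes of `π^{Comb}` -/
def combType (T : CTree) : Multiset ℕ :=
  (if (combAux T).1 = 0 then (0 : Multiset ℕ) else {(combAux T).1}) + (combAux T).2

/-- subtrees (= nodes) of a tree -/
def subtreesC : CTree → List CTree
  | leaf m => [leaf m]
  | node c l r => node c l r :: (subtreesC l ++ subtreesC r)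

end CTree

/-- normalized uncolored labeled binary trees on `[n]`: the set `Nor_n`. -/
def NorSet (n : ℕ) : Set CTree :=
  {T | T.OnSet n ∧ T.Normalized ∧ T.Mono}

/-- `Lyn_μ` for a weak composition `μ` (indexed by ℕ; `μ i` is the number of
internal nodes of color `i`). -/
def LynSet (n : ℕ) (μ : ℕ →₀ ℕ) : Set CTree :=
  {T | T.OnSet n ∧ T.Normalized ∧ T.LynColored ∧ ∀ j, T.colorCount j = μ j}

/-- `Comb_μ` -/
def CombSet (n : ℕ) (μ : ℕ →₀ ℕ) : Set CTree :=
  {T | T.OnSet n ∧ T.Normalized ∧ T.CombColored ∧ ∀ j, T.colorCount j = μ j}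

/-- `Lyn_μ` for `μ ∈ wcomp` with support in `[k]`, given as `f : Fin k → ℕ`. -/
def LynSetF (n k : ℕ) (f : Fin k → ℕ) : Set CTree :=
  {T | T.OnSet n ∧ T.Normalized ∧ T.LynColored ∧
    ∀ j : ℕ, T.colorCount j = if h : j < k then f ⟨j, h⟩ else 0}

def CombSetF (n k : ℕ) (f : Fin k → ℕ) : Set CTree :=
  {T | T.OnSet n ∧ T.Normalized ∧ T.CombColored ∧
    ∀ j : ℕ, T.colorCount j = if h : j < k then f ⟨j, h⟩ else 0}

open MvPolynomial

/-- the complete homogeneous symmetric polynomial `h_m(x_1,…,x_k)` -/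
noncomputable def hpoly (k m : ℕ) : MvPolynomial (Fin k) ℚ :=
  ∑ f ∈ Finset.Nat.antidiagonalTuple k m, ∏ i, X i ^ f i

/-- `L_m(x_1,…,x_k) = Σ_{μ ∈ wcomp_m, supp(μ) ⊆ [k]} |Lyn_μ| x^μ`;
`Lyn_μ` consists of colored Lyndon trees on `[m+1]`. -/
noncomputable def Lpoly (k m : ℕ) : MvPolynomial (Fin k) ℚ :=
  ∑ f ∈ Finset.Nat.antidiagonalTuple k m,
    (Nat.card (LynSetF (m + 1) k f) : MvPolynomial (Fin k) ℚ) * ∏ i, X i ^ f i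

/-- `L_{λ∖(1^{ℓ(λ)})} = Π_i L_{λ_i - 1}` for a partition `λ` given as a multiset -/
noncomputable def LprodShift (k : ℕ) (lam : Multiset ℕ) : MvPolynomial (Fin k) ℚ :=
  (lam.map fun s => Lpoly k (s - 1)).prod

/-- `h_{λ∖(1^{ℓ(λ)})} = Π_i h_{λ_i - 1}` -/
noncomputable def hprodShift (k : ℕ) (lam : Multiset ℕ) : MvPolynomial (Fin k) ℚ :=
  (lam.map fun s => hpoly k (s - 1)).prod

/-- the rational coefficient `(i choose λ)·(1/m(λ)!) = i!/(Π λⱼ! · Π_s m_s(λ)!)` -/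
noncomputable def qcoef (i : ℕ) (lam : Multiset ℕ) : ℚ :=
  (i.factorial : ℚ) /
    (((lam.map Nat.factorial).prod : ℕ) *
      (lam.toFinset.prod fun s => (lam.count s).factorial))

/-- the set of integer partitions `λ ⊢ i` with `ℓ(λ) = j` parts -/
def ParSet (i j : ℕ) : Set (Multiset ℕ) :=
  {lam | lam.sum = i ∧ lam.card = j ∧ 0 ∉ lam}

namespace LW

open CTree Finset

def lv (T : CTree) : Finset ℕ := T.leavesList.toFinset

/-- admissible trees -/
def Ok (k : ℕ) (T : CTree) : Prop :=
  T.leavesList.Nodup ∧ T.Normalized ∧ T.LynColored ∧ ∀ j, k ≤ j → T.colorCount j = 0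

/-- size of a tree -/
def depth : CTree → ℕ
  | leaf _ => 1
  | node _ l r => depth l + depth r

theorem depth_eq (T : CTree) : depth T = T.leavesList.length := by
  induction T with
  | leaf m => simp [depth, leavesList]
  | node c l r hl hr => simp [depth, leavesList, hl, hr]

theorem depth_pos (T : CTree) : 0 < depth T := by
  induction T with
  | leaf m => simp [depth]
  | node c l r hl hr => simp [depth]; omega

def allT (k : ℕ) (S : Finset ℕ) : ℕ → Finset CTree
  | 0 => ∅
  | d + 1 => S.image leaf ∪
      ((range k) ×ˢ (allT k S d ×ˢ allT k S d)).image (fun q => node q.1 q.2.1 q.2.2)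

theorem mem_allT (k : ℕ) (S : Finset ℕ) (T : CTree) : ∀ d, depth T ≤ d → lv T ⊆ S →
    (∀ j, k ≤ j → T.colorCount j = 0) → T ∈ allT k S d := by
  induction T with
  | leaf m =>
    intro d hd hS _
    cases d with
    | zero => simp [depth] at hd
    | succ d => simp [allT]; simpa [lv, leavesList] using hS
  | node c l r hl hr =>
    intro d hd hS hc
    have := depth_pos l
    have := depth_pos r
    cases d with
    | zero => simp [depth] at hd; omega
    | succ d =>
      simp only [depth] at hd
      simp only [allT, mem_union, mem_image, mem_product, mem_range]
      right
      refine ⟨(c, l, r), ⟨?_, ?_, ?_⟩, rfl⟩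
      · by_contra h
        have := hc c (by simpa using h)
        simp [colorCount] at this
      · refine hl d (by omega) (fun x hx => hS ?_) (fun j hj => ?_)
        · simp [lv, leavesList] at hx ⊢; simp [hx]
        · have := hc j hj; simp [colorCount] at this; omega
      · refine hr d (by omega) (fun x hx => hS ?_) (fun j hj => ?_)
        · simp [lv, leavesList] at hx ⊢; simp [hx]
        · have := hc j hj; simp [colorCount] at this; omega

open Classical in
/-- trees with leaves in `S`, containing the minimum of `S` -/
noncomputable def K (k : ℕ) (S : Finset ℕ) : Finset CTree :=
  (allT k S S.card).filter (fun T => Ok k T ∧ lv T ⊆ S ∧ ∀ s ∈ S, T.minLeaf ≤ s)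

theorem mem_K {k : ℕ} {S : Finset ℕ} {T : CTree} :
    T ∈ K k S ↔ Ok k T ∧ lv T ⊆ S ∧ ∀ s ∈ S, T.minLeaf ≤ s := by
  classical
  simp only [K, mem_filter, and_iff_right_iff_imp]
  rintro ⟨h1, h2, h3⟩
  apply mem_allT _ _ _ _ _ h2 h1.2.2.2
  rw [depth_eq, ← List.toFinset_card_of_nodup h1.1]
  exact card_le_card h2

theorem minLeaf_mem (T : CTree) : T.minLeaf ∈ lv T := by
  induction T with
  | leaf m => simp [lv, leavesList, minLeaf]
  | node c l r hl hr =>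
    simp only [lv, leavesList, minLeaf, List.mem_toFinset, List.mem_append] at *
    rcases min_choice l.minLeaf r.minLeaf with h | h <;> rw [h] <;> simp [hl, hr]

theorem minLeaf_le (T : CTree) : ∀ s ∈ lv T, T.minLeaf ≤ s := by
  induction T with
  | leaf m => simp [lv, leavesList, minLeaf]
  | node c l r hl hr =>
    intro s hs
    simp only [lv, leavesList, minLeaf, List.mem_toFinset, List.mem_append] at *
    rcases hs with h | h
    · exact (min_le_left _ _).trans (hl s h)
    · exact (min_le_right _ _).trans (hr s h)

theorem lv_node (c l r) : lv (node c l r) = lv l ∪ lv r := by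
  simp [lv, leavesList]

noncomputable def xv (k : ℕ) (c : ℕ) : MvPolynomial (Fin k) ℚ :=
  if h : c < k then X ⟨c, h⟩ else 0

noncomputable def wt (k : ℕ) (T : CTree) : MvPolynomial (Fin k) ℚ :=
  ∏ i : Fin k, X i ^ T.colorCount i

theorem wt_node (k c : ℕ) (l r) (hc : c < k) :
    wt k (node c l r) = xv k c * wt k l * wt k r := by
  simp only [wt, colorCount, pow_add, prod_mul_distrib, xv, hc, dif_pos]
  congr 2
  rw [prod_eq_single ⟨c, hc⟩]
  · simp
  · intro b _ hb
    have : c ≠ b := fun h => hb (by ext; exact h.symm)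
    simp [this]
  · simp

theorem wt_leaf (k m : ℕ) : wt k (leaf m) = 1 := by
  simp [wt, colorCount]

noncomputable def H (k : ℕ) : ℕ → ℕ → MvPolynomial (Fin k) ℚ
  | 0, _ => 1
  | p + 1, c => ∑ d ∈ (range k).filter (fun d => c ≤ d), xv k d * H k p d

noncomputable def U (k : ℕ) : ℕ → Finset ℕ → MvPolynomial (Fin k) ℚ
  | 0, S => if S = ∅ then 1 else 0
  | p + 1, S => ∑ T ∈ K k S, wt k T * U k p (S \ lv T)

theorem U_zero_of_card (k p : ℕ) : ∀ S : Finset ℕ, S.card < p → U k p S = 0 := by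
  induction p with
  | zero => simp
  | succ p ih =>
    intro S hS
    rw [U]
    apply sum_eq_zero
    intro T hT
    rw [mem_K] at hT
    rw [ih, mul_zero]
    have h1 := card_lt_card (sdiff_ssubset hT.2.1 ⟨_, minLeaf_mem T⟩)
    omega

def Good (S : Finset ℕ) (T : CTree) : Prop :=
  T.isLeafB = false ∧ ∀ s ∈ S \ lv T, T.right.minLeaf < s

open Classical in
noncomputable def M (k p : ℕ) (S : Finset ℕ) : MvPolynomial (Fin k) ℚ :=
  ∑ T ∈ (K k S).filter (Good S), wt k T * (H k p T.rootColor * U k p (S \ lv T))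

def LynOk (c : ℕ) (l r : CTree) : Prop :=
  RootLyndonB (node c l r) = true ∨ c < rootColor l

theorem node_mem_K {k c : ℕ} {S : Finset ℕ} {l r : CTree} :
    (node c l r ∈ K k S ∧ Good S (node c l r)) ↔
      (l ∈ K k S ∧ r ∈ K k (S \ lv l) ∧ c < k ∧ LynOk c l r) := by
  simp only [mem_K, Good, Ok]
  have hl := minLeaf_mem l
  have hr := minLeaf_mem r
  have hl' := minLeaf_le l
  have hr' := minLeaf_le r
  simp only [leavesList, List.nodup_append, Normalized, LynColored, lv_node, minLeaf, isLeafB,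
    right, colorCount]
  constructor
  · rintro ⟨⟨⟨⟨n1, n2, n3⟩, ⟨m1, m2, m3⟩, ⟨c1, c2, c3⟩, hc⟩, h1, h2⟩, -, h3⟩
    refine ⟨⟨⟨n1, m1, c1, fun j hj => ?_⟩, ?_, ?_⟩, ⟨⟨n2, m2, c2, fun j hj => ?_⟩, ?_, ?_⟩, ?_, c3⟩
    · have := hc j hj; omega
    · exact subset_union_left.trans h1
    · intro s hs
      have := h2 s hs
      rwa [min_eq_left m3.le] at this
    · have := hc j hj; omega
    · intro x hx
      rw [mem_sdiff]
      refine ⟨h1 (mem_union_right _ hx), fun hx' => ?_⟩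
      simp only [lv, List.mem_toFinset] at hx hx'
      exact n3 x hx' x hx rfl
    · intro s hs
      rw [mem_sdiff] at hs
      by_cases h : s ∈ lv r
      · exact hr' s h
      · exact (h3 s (by simp [hs, h])).le
    · by_contra h
      have := hc c (by omega)
      simp at this
  · rintro ⟨⟨⟨n1, m1, c1, k1⟩, s1, l1⟩, ⟨⟨n2, m2, c2, k2⟩, s2, l2⟩, hc, ho⟩
    have hd : ∀ x ∈ lv r, x ∈ S ∧ x ∉ lv l := fun x hx => by simpa using s2 hx
    have hlt : l.minLeaf < r.minLeaf := by
      apply lt_of_le_of_ne (l1 _ (hd _ hr).1)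
      intro h
      exact (hd _ hr).2 (h ▸ hl)
    refine ⟨⟨⟨⟨n1, n2, ?_⟩, ⟨m1, m2, hlt⟩, ⟨c1, c2, ho⟩, fun j hj => ?_⟩, ?_, ?_⟩, trivial, ?_⟩
    · rintro a ha b hb rfl
      exact (hd a (by simpa [lv] using hb)).2 (by simpa [lv] using ha)
    · rw [k1 j hj, k2 j hj, if_neg (by omega)]
    · exact union_subset s1 (fun x hx => (hd x hx).1)
    · intro s hs
      exact (min_le_left _ _).trans (l1 s hs)
    · intro s hs
      simp only [mem_sdiff, mem_union, not_or] at hs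
      apply lt_of_le_of_ne (l2 s (by simp [hs]))
      intro h
      exact hs.2.2 (h ▸ hr)

theorem not_lynOk {k c : ℕ} {S : Finset ℕ} {l r : CTree} (hl : l ∈ K k S)
    (hr : r ∈ K k (S \ lv l)) : ¬ LynOk c l r ↔ (Good S l ∧ l.rootColor ≤ c) := by
  rw [mem_K] at hl hr
  have hrm := hr.2.1 (minLeaf_mem r)
  cases l with
  | leaf m => simp [LynOk, RootLyndonB, Good, isLeafB, left]
  | node c0 l' r0 =>
    have e : RootLyndonB (node c (node c0 l' r0) r) = true ↔ r.minLeaf < r0.minLeaf := by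
      show (false || false || decide (r.minLeaf < r0.minLeaf)) = true ↔ _
      simp
    simp only [LynOk, e, isLeafB, right, Good, rootColor]
    simp only [not_or, not_lt, true_and]
    refine and_congr_left fun _ => ?_
    constructor
    · intro h s hs
      have h2 := hr.2.2 s hs
      apply lt_of_le_of_ne (h.trans h2)
      intro he
      apply (mem_sdiff.1 hs).2
      rw [lv_node, ← he]
      exact mem_union_right _ (minLeaf_mem r0)
    · intro h
      exact (h _ hrm).le

theorem N_eq (k p : ℕ) (S : Finset ℕ) :
    H k (p + 1) 0 * U k (p + 2) S = M k p S + M k (p + 1) S := by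
  classical
  have key : H k (p + 1) 0 * U k (p + 2) S =
      ∑ l ∈ K k S, ∑ r ∈ K k (S \ lv l), ∑ c ∈ range k,
        wt k l * wt k r * xv k c * H k p c * U k p (S \ (lv l ∪ lv r)) := by
    rw [U, mul_sum]
    refine sum_congr rfl fun l _ => ?_
    rw [U, H, mul_sum, mul_sum]
    refine sum_congr rfl fun r _ => ?_
    simp only [Nat.zero_le, filter_true, sum_mul]
    refine sum_congr rfl fun c _ => ?_
    rw [sdiff_sdiff_left]
    simp only [sup_eq_union]
    ring
  have h1 : M k p S = ∑ l ∈ K k S, ∑ r ∈ K k (S \ lv l), ∑ c ∈ (range k).filter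
      (fun c => LynOk c l r),
        wt k l * wt k r * xv k c * H k p c * U k p (S \ (lv l ∪ lv r)) := by
    rw [M]
    simp only [sum_sigma']
    symm
    refine sum_bij (fun (q : (_ : CTree) × (_ : CTree) × ℕ) _ => node q.2.2 q.1 q.2.1) ?_ ?_ ?_ ?_
    · rintro ⟨l, r, c⟩ h
      simp only [mem_sigma, mem_filter, mem_range] at h ⊢
      rw [node_mem_K]
      tauto
    · rintro ⟨l, r, c⟩ h ⟨l', r', c'⟩ h' he
      simp only [node.injEq] at he
      obtain ⟨rfl, rfl, rfl⟩ := he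
      rfl
    · intro T hT
      rw [mem_filter] at hT
      cases T with
      | leaf m => exact absurd hT.2.1 (by simp [isLeafB])
      | node c l r =>
        rw [node_mem_K] at hT
        refine ⟨⟨l, r, c⟩, ?_, rfl⟩
        simp only [mem_sigma, mem_filter, mem_range]
        tauto
    · rintro ⟨l, r, c⟩ h
      simp only [mem_sigma, mem_filter, mem_range] at h
      rw [wt_node _ _ _ _ h.2.2.1, lv_node, rootColor]
      ring
  have h2 : M k (p + 1) S = ∑ l ∈ K k S, ∑ r ∈ K k (S \ lv l), ∑ c ∈ (range k).filter
      (fun c => ¬ LynOk c l r),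
        wt k l * wt k r * xv k c * H k p c * U k p (S \ (lv l ∪ lv r)) := by
    rw [M, sum_filter]
    refine sum_congr rfl fun l hl => ?_
    split_ifs with hg
    · rw [U, H, mul_sum, mul_sum]
      refine sum_congr rfl fun r hr => ?_
      rw [sum_mul, mul_sum]
      refine sum_congr ?_ fun c _ => ?_
      · ext c
        simp [not_lynOk hl hr, hg]
      · rw [sdiff_sdiff_left]
        simp only [sup_eq_union]
        ring
    · symm
      refine sum_eq_zero fun r hr => ?_
      rw [filter_false_of_mem, sum_empty]
      intro c _
      rw [not_lynOk hl hr]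
      tauto
  rw [key, h1, h2, ← sum_add_distrib]
  refine sum_congr rfl fun l _ => ?_
  rw [← sum_add_distrib]
  refine sum_congr rfl fun r _ => ?_
  exact (sum_filter_add_sum_filter_not _ _ _).symm

theorem Ok_leaf (k m : ℕ) : Ok k (leaf m) := by
  simp [Ok, leavesList, Normalized, LynColored, colorCount]

theorem N_zero (k : ℕ) (S : Finset ℕ) :
    U k 1 S = M k 0 S + if S.card = 1 then 1 else 0 := by
  classical
  rw [U, M, ← sum_filter_add_sum_filter_not (K k S) (Good S)]
  congr 1
  · refine sum_congr rfl fun T _ => ?_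
    rw [H, one_mul]
  · split_ifs with h
    · obtain ⟨m, rfl⟩ := card_eq_one.1 h
      rw [sum_eq_single (leaf m)]
      · simp [wt_leaf, U, lv, leavesList]
      · intro T hT hne
        exfalso
        rw [mem_filter, mem_K] at hT
        obtain ⟨⟨h1, h2, h3⟩, h4⟩ := hT
        cases T with
        | leaf a =>
          apply hne
          have := h2 (minLeaf_mem _)
          simp [minLeaf] at this
          rw [this]
        | node c l r =>
          apply h4
          refine ⟨rfl, ?_⟩
          have : lv (node c l r) = {m} := by
            apply Subset.antisymm h2
            have := minLeaf_mem (node c l r)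
            have h5 := mem_singleton.1 (h2 this)
            rw [h5] at this
            simpa using this
          simp [this]
      · intro hn
        exfalso
        apply hn
        rw [mem_filter, mem_K]
        refine ⟨⟨Ok_leaf _ _, ?_, ?_⟩, ?_⟩
        · simp [lv, leavesList]
        · simp [minLeaf]
        · simp [Good, isLeafB]
    · refine sum_eq_zero fun T hT => ?_
      rw [mem_filter, mem_K] at hT
      obtain ⟨⟨h1, h2, h3⟩, h4⟩ := hT
      rw [U, if_neg, mul_zero]
      intro he
      cases T with
      | leaf a =>
        apply h
        have : S = {a} := by
          apply Subset.antisymm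
          · rw [sdiff_eq_empty_iff_subset] at he
            simpa [lv, leavesList] using he
          · simpa [lv, leavesList] using h2
        simp [this]
      | node c l r =>
        apply h4
        refine ⟨rfl, ?_⟩
        simp [he]

theorem M_zero (k p : ℕ) (S : Finset ℕ) (h : S.card ≤ p) : M k p S = 0 := by
  classical
  rw [M]
  refine sum_eq_zero fun T hT => ?_
  rw [mem_filter, mem_K] at hT
  have h1 := card_lt_card (sdiff_ssubset hT.1.2.1 ⟨_, minLeaf_mem T⟩)
  rw [U_zero_of_card _ _ _ (by omega)]
  simp

theorem telescope (k : ℕ) (S : Finset ℕ) (P : ℕ) :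
    ∑ p ∈ range (P + 1), (-1) ^ p * (H k p 0 * U k (p + 1) S) =
      (if S.card = 1 then 1 else 0) + (-1) ^ P * M k P S := by
  induction P with
  | zero => simp [H, N_zero]; ring
  | succ P ih => rw [sum_range_succ, ih, N_eq]; ring

theorem main_rel (k : ℕ) (S : Finset ℕ) (P : ℕ) (h : S.card ≤ P) :
    ∑ p ∈ range (P + 1), (-1) ^ p * (H k p 0 * U k (p + 1) S) =
      (if S.card = 1 then 1 else 0) := by
  rw [telescope, M_zero _ _ _ h]; simp

noncomputable def egf {k : ℕ} (a : ℕ → MvPolynomial (Fin k) ℚ) :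
    PowerSeries (MvPolynomial (Fin k) ℚ) :=
  PowerSeries.mk fun n => ((n.factorial : ℚ)⁻¹) • a n

noncomputable def y {k : ℕ} (a : ℕ → MvPolynomial (Fin k) ℚ) (p n : ℕ) :
    MvPolynomial (Fin k) ℚ :=
  ((n.factorial : ℚ) / p.factorial) • PowerSeries.coeff n (egf a ^ p)

theorem y_zero {k : ℕ} (a : ℕ → MvPolynomial (Fin k) ℚ) (n : ℕ) :
    y a 0 n = if n = 0 then 1 else 0 := by
  simp only [y, pow_zero, PowerSeries.coeff_one]
  split_ifs with h
  · simp [h]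
  · simp

theorem y_one {k : ℕ} (a : ℕ → MvPolynomial (Fin k) ℚ) (n : ℕ) :
    y a 1 n = a n := by
  simp only [y, pow_one, egf, PowerSeries.coeff_mk, smul_smul]
  have : (n.factorial : ℚ) ≠ 0 := by positivity
  simp [this]

theorem y_succ_zero {k : ℕ} (a : ℕ → MvPolynomial (Fin k) ℚ) (h : a 0 = 0) (p : ℕ) :
    y a (p + 1) 0 = 0 := by
  simp [y, egf, h]

theorem y_succ_succ {k : ℕ} (a : ℕ → MvPolynomial (Fin k) ℚ) (p n : ℕ) :
    y a (p + 1) (n + 1) =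
      ∑ s ∈ range (n + 1), n.choose s • (a (s + 1) * y a p (n - s)) := by
  have h := congrArg (PowerSeries.coeff n) (PowerSeries.derivative_pow (egf a) (p + 1))
  rw [PowerSeries.coeff_derivative, Nat.add_sub_cancel, mul_assoc, ← nsmul_eq_mul,
    map_nsmul, mul_comm (egf a ^ p), PowerSeries.coeff_mul,
    Finset.Nat.sum_antidiagonal_eq_sum_range_succ_mk] at h
  have h1 : y a (p + 1) (n + 1) = ((n.factorial : ℚ) / (p + 1).factorial) •
      (PowerSeries.coeff (n + 1) (egf a ^ (p + 1)) * ((n : MvPolynomial (Fin k) ℚ) + 1)) := by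
    rw [y, Nat.factorial_succ n]
    simp only [MvPolynomial.smul_eq_C_mul]
    rw [show ((n : MvPolynomial (Fin k) ℚ) + 1) = C ((n : ℚ) + 1) by simp, mul_comm _ (C _),
      ← mul_assoc, ← C_mul]
    congr 2
    push_cast
    ring
  rw [h1, h, smul_sum, smul_sum]
  refine sum_congr rfl fun s hs => ?_
  rw [mem_range] at hs
  simp only [PowerSeries.coeff_derivative, y, egf, PowerSeries.coeff_mk]
  generalize PowerSeries.coeff (n - s)
    ((PowerSeries.mk fun n => ((n.factorial : ℚ)⁻¹) • a n) ^ p) = Q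
  have hch : (n.choose s : ℚ) = n.factorial / (s.factorial * (n - s).factorial) :=
    Nat.cast_choose ℚ (by omega)
  rw [← Nat.cast_smul_eq_nsmul ℚ, ← Nat.cast_smul_eq_nsmul ℚ, hch]
  rw [show ((s : MvPolynomial (Fin k) ℚ) + 1) = C ((s : ℚ) + 1) by simp]
  simp only [MvPolynomial.smul_eq_C_mul]
  have e : ((n.factorial : ℚ) / (p + 1).factorial) * (((p + 1 : ℕ) : ℚ) *
      ((((s + 1).factorial : ℚ))⁻¹ * ((s : ℚ) + 1))) =
      n.factorial / (s.factorial * (n - s).factorial) * ((n - s).factorial / p.factorial) := by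
    rw [Nat.factorial_succ, Nat.factorial_succ]
    have h1 : (s.factorial : ℚ) ≠ 0 := by positivity
    have h2 : (p.factorial : ℚ) ≠ 0 := by positivity
    have h3 : ((n - s).factorial : ℚ) ≠ 0 := by positivity
    push_cast
    field_simp
  have e' := congrArg (C (σ := Fin k)) e
  simp only [C_mul] at e'
  linear_combination (a (s + 1) * Q) * e'

theorem U_one (k : ℕ) (S : Finset ℕ) :
    U k 1 S = ∑ T ∈ (K k S).filter (fun T => lv T = S), wt k T := by
  rw [U, sum_filter]
  refine sum_congr rfl fun T hT => ?_
  rw [mem_K] at hT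
  rw [U]
  by_cases h : lv T = S
  · simp [h]
  · rw [if_neg h, if_neg, mul_zero]
    rw [sdiff_eq_empty_iff_subset]
    exact fun h' => h (hT.2.1.antisymm h')

theorem U_insert (k p m : ℕ) (S : Finset ℕ) (hm : ∀ s ∈ S, m < s) :
    U k (p + 1) (insert m S) = ∑ B ∈ S.powerset, U k 1 (insert m B) * U k p (S \ B) := by
  have hmS : m ∉ S := fun h => lt_irrefl _ (hm m h)
  have hmin : ∀ T ∈ K k (insert m S), m ∈ lv T := by
    intro T hT
    rw [mem_K] at hT
    have h1 := hT.2.2 m (mem_insert_self _ _)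
    have h2 := minLeaf_mem T
    rcases mem_insert.1 (hT.2.1 h2) with h | h
    · exact h ▸ h2
    · exact absurd (hm _ h) (by omega)
  rw [U, ← sum_fiberwise_of_maps_to (t := S.powerset) (g := fun T => (lv T).erase m)]
  · refine sum_congr rfl fun B hB => ?_
    rw [mem_powerset] at hB
    rw [U_one, sum_mul]
    refine sum_congr ?_ ?_
    · ext T
      simp only [mem_filter]
      constructor
      · rintro ⟨h, rfl⟩
        have hmT := hmin T h
        rw [insert_erase hmT]
        rw [mem_K] at h ⊢
        exact ⟨⟨h.1, Subset.rfl, fun s hs => h.2.2 s (h.2.1 hs)⟩, rfl⟩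
      · rintro ⟨h, h'⟩
        rw [mem_K] at h ⊢
        refine ⟨⟨h.1, h.2.1.trans (insert_subset_insert _ hB), ?_⟩, ?_⟩
        · intro s hs
          have h1 := h.2.2 m (mem_insert_self _ _)
          rcases mem_insert.1 hs with rfl | hs
          · exact h1
          · exact h1.trans (hm s hs).le
        · rw [h', erase_insert]
          exact fun h => hmS (hB h)
    · intro T hT
      rw [mem_filter] at hT
      rw [hT.2]
      congr 2
      ext x
      simp only [mem_sdiff, mem_insert, not_or]
      constructor
      · rintro ⟨rfl | h, h1, h2⟩
        · exact absurd rfl h1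
        · exact ⟨h, h2⟩
      · rintro ⟨h1, h2⟩
        exact ⟨Or.inr h1, fun h => hmS (h ▸ h1), h2⟩
  · intro T hT
    rw [mem_K] at hT
    rw [mem_powerset, ← subset_insert_iff]
    exact hT.2.1

noncomputable def w (k n : ℕ) : MvPolynomial (Fin k) ℚ := U k 1 (Icc 1 n)

theorem w_zero (k : ℕ) : w k 0 = 0 := by
  rw [w]; apply U_zero_of_card; simp

theorem U_card (k n : ℕ) : ∀ (S : Finset ℕ), S.card = n → ∀ p, U k p S = y (w k) p n := by
  induction n using Nat.strong_induction_on with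
  | _ n ih =>
  cases n with
  | zero =>
    intro S hS p
    cases p with
    | zero => rw [y_zero]; simpa [U] using hS
    | succ p =>
      rw [y_succ_zero _ (w_zero k), U_zero_of_card]
      omega
  | succ n =>
    have big : ∀ S : Finset ℕ, S.card = n + 1 → ∀ q, U k (q + 2) S = y (w k) (q + 2) (n + 1) := by
      intro S hS q
      have hne : S.Nonempty := by rw [← card_pos]; omega
      have hS' : insert (S.min' hne) (S.erase (S.min' hne)) = S := insert_erase (min'_mem _ _)
      have hc : (S.erase (S.min' hne)).card = n := by
        rw [card_erase_of_mem (min'_mem _ _)]; omega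
      have hlt : ∀ s ∈ S.erase (S.min' hne), S.min' hne < s := fun s hs =>
        min'_lt_of_mem_erase_min' _ _ hs
      rw [← hS']
      generalize S.min' hne = m at *
      generalize S.erase m = S' at *
      rw [U_insert _ _ _ _ hlt, y_succ_succ]
      subst hc
      rw [← sum_powerset_apply_card (fun s => w k (s + 1) * y (w k) (q + 1) (S'.card - s))]
      refine sum_congr rfl fun B hB => ?_
      rw [mem_powerset] at hB
      have hBc : (S' \ B).card = S'.card - B.card := card_sdiff_of_subset hB
      rw [ih _ (by omega) _ hBc]
      by_cases hlt' : B.card < S'.card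
      · rw [ih (B.card + 1) (by omega) (insert m B), y_one]
        rw [card_insert_of_notMem]
        exact fun h => lt_irrefl _ (hlt m (hB h))
      · rw [show S'.card - B.card = 0 by omega, y_succ_zero _ (w_zero k)]
        simp
    intro S hS p
    match p with
    | 0 =>
      rw [y_zero, U, if_neg, if_neg (by omega)]
      rintro rfl
      simp at hS
    | q + 2 => exact big S hS q
    | 1 =>
      rw [y_one]
      have hI : (Icc 1 (n + 1)).card = n + 1 := by simp
      have e1 := main_rel k S (n + 1) (by omega)
      have e2 := main_rel k (Icc 1 (n + 1)) (n + 1) (by omega)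
      rw [hS, sum_range_succ'] at e1
      rw [hI, ← e1, sum_range_succ'] at e2
      simp only [big S hS, big _ hI] at e2
      simp only [pow_zero, one_mul, H, zero_add] at e2
      rw [w]
      exact (add_left_cancel e2).symm

theorem rel (k n : ℕ) :
    ∑ p ∈ range (n + 1), (-1) ^ p * (H k p 0 * y (w k) (p + 1) n) = if n = 1 then 1 else 0 := by
  have := main_rel k (Icc 1 n) n (by simp)
  simpa [U_card k n (Icc 1 n) (by simp)] using this

/-! complete homogeneous polynomials -/

theorem sum_antidiagonalTuple_succ {R : Type*} [CommRing R] (d p : ℕ) (x : ℕ → R) :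
    ∑ f ∈ Finset.Nat.antidiagonalTuple (d + 1) p, ∏ i : Fin (d + 1), x i ^ f i =
      ∑ q ∈ antidiagonal p, x 0 ^ q.1 *
        ∑ f ∈ Finset.Nat.antidiagonalTuple d q.2, ∏ i : Fin d, x (i + 1) ^ f i := by
  simp only [mul_sum, sum_sigma']
  symm
  refine sum_bij (fun (q : (_ : ℕ × ℕ) × (Fin d → ℕ)) _ => Fin.cons q.1.1 q.2) ?_ ?_ ?_ ?_
  · rintro ⟨⟨a, b⟩, f⟩ h
    simp [Finset.Nat.mem_antidiagonalTuple] at h ⊢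
    rw [h.2, h.1]
  · rintro ⟨⟨a, b⟩, f⟩ h ⟨⟨a', b'⟩, f'⟩ h' he
    simp [Finset.Nat.mem_antidiagonalTuple] at h h'
    have he := Fin.cons_injective2 he
    obtain ⟨h1, h2⟩ := he
    simp only at h1 h2
    subst h1 h2
    have : b = b' := by omega
    subst this
    rfl
  · intro f hf
    rw [Finset.Nat.mem_antidiagonalTuple, Fin.sum_univ_succ] at hf
    refine ⟨⟨(f 0, ∑ i : Fin d, f i.succ), Fin.tail f⟩, ?_, ?_⟩
    · simp [Finset.Nat.mem_antidiagonalTuple, hf, Fin.tail]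
    · simp
  · rintro ⟨⟨a, b⟩, f⟩ h
    rw [Fin.prod_univ_succ]
    simp

theorem H_rec (k p c : ℕ) (hc : c < k) :
    H k (p + 1) c = xv k c * H k p c + H k (p + 1) (c + 1) := by
  rw [H, H]
  have : (range k).filter (fun d => c ≤ d) =
      insert c ((range k).filter (fun d => c + 1 ≤ d)) := by
    ext x; simp; omega
  rw [this, sum_insert (by simp)]

theorem hs_eq (k d : ℕ) : ∀ c, c + d = k → ∀ p,
    ∑ f ∈ Finset.Nat.antidiagonalTuple d p, ∏ i : Fin d, xv k (c + i) ^ f i = H k p c := by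
  induction d with
  | zero =>
    intro c hc p
    cases p with
    | zero => simp [H]
    | succ p =>
      rw [H, filter_false_of_mem]
      · simp
      · intro x hx
        rw [mem_range] at hx
        omega
  | succ d ih =>
    intro c hc p
    have key : ∀ p, ∑ f ∈ Finset.Nat.antidiagonalTuple (d + 1) p,
        ∏ i : Fin (d + 1), xv k (c + i) ^ f i =
        ∑ q ∈ antidiagonal p, xv k c ^ q.1 * H k q.2 (c + 1) := by
      intro p
      rw [sum_antidiagonalTuple_succ d p (fun i => xv k (c + i))]
      refine sum_congr rfl fun q _ => ?_
      rw [← ih (c + 1) (by omega) q.2]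
      simp only [add_zero, add_assoc, add_comm 1]
    rw [key]
    induction p with
    | zero => simp [H]
    | succ p ihp =>
      rw [Finset.Nat.sum_antidiagonal_succ, H_rec k p c (by omega), ← ihp, mul_sum, add_comm]
      congr 1
      · refine sum_congr rfl fun q _ => ?_
        simp only
        ring
      · simp

theorem hpoly_eq (k p : ℕ) : hpoly k p = H k p 0 := by
  rw [← hs_eq k k 0 (by omega) p, hpoly]
  refine sum_congr rfl fun f _ => prod_congr rfl fun i _ => ?_
  simp [xv]

/-! Lyndon polynomials -/

theorem colorCount_sum (k : ℕ) (T : CTree) (h : ∀ j, k ≤ j → T.colorCount j = 0) :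
    ∑ i : Fin k, T.colorCount i + 1 = T.leavesList.length := by
  induction T with
  | leaf m => simp [colorCount, leavesList]
  | node c l r hl hr =>
    have hc : c < k := by
      by_contra hh
      have := h c (by omega)
      simp [colorCount] at this
    have h1 := hl fun j hj => by have := h j hj; simp only [colorCount] at this; omega
    have h2 := hr fun j hj => by have := h j hj; simp only [colorCount] at this; omega
    simp only [colorCount, leavesList, sum_add_distrib, List.length_append]
    have : ∑ i : Fin k, (if c = (i : ℕ) then 1 else 0) = 1 := by
      rw [sum_eq_single ⟨c, hc⟩]
      · simp
      · intro b _ hb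
        rw [if_neg]
        exact fun h => hb (by ext; exact h.symm)
      · simp
    omega

theorem onSet_iff (n : ℕ) (T : CTree) :
    T.OnSet n ↔ T.leavesList.Nodup ∧ lv T = Icc 1 n := by
  have hn : ((List.range n).map (· + 1)).Nodup :=
    List.nodup_range.map (fun a b h => by simpa using h)
  have hf : ((List.range n).map (· + 1)).toFinset = Icc 1 n := by
    ext x
    simp only [List.mem_toFinset, List.mem_map, List.mem_range, mem_Icc]
    constructor
    · rintro ⟨a, h, rfl⟩; omega
    · intro h; exact ⟨x - 1, by omega, by omega⟩
  rw [OnSet]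
  constructor
  · intro h
    exact ⟨h.nodup_iff.2 hn, by rw [lv, ← hf]; exact List.toFinset_eq_of_perm _ _ h⟩
  · rintro ⟨h1, h2⟩
    apply List.perm_of_nodup_nodup_toFinset_eq h1 hn
    rw [hf]; exact h2

theorem mem_LynSetF (m k : ℕ) (f : Fin k → ℕ) (T : CTree) :
    T ∈ LynSetF (m + 1) k f ↔
      (T ∈ K k (Icc 1 (m + 1)) ∧ lv T = Icc 1 (m + 1)) ∧ (fun i : Fin k => T.colorCount i) = f := by
  simp only [LynSetF, Set.mem_ofPred_eq, onSet_iff, mem_K, Ok]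
  constructor
  · rintro ⟨⟨h1, h2⟩, h3, h4, h5⟩
    refine ⟨⟨⟨⟨h1, h3, h4, fun j hj => ?_⟩, h2.le, ?_⟩, h2⟩, ?_⟩
    · rw [h5, dif_neg (by omega)]
    · rw [← h2]; exact minLeaf_le T
    · funext i
      rw [h5, dif_pos i.2]
  · rintro ⟨⟨⟨⟨h1, h3, h4, h5⟩, -⟩, h2⟩, rfl⟩
    refine ⟨⟨h1, h2⟩, h3, h4, fun j => ?_⟩
    split_ifs with h
    · rfl
    · exact h5 j (by omega)

theorem Lpoly_eq (k m : ℕ) : Lpoly k m = w k (m + 1) := by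
  classical
  have hmap : ∀ T ∈ (K k (Icc 1 (m + 1))).filter (fun T => lv T = Icc 1 (m + 1)),
      (fun i : Fin k => T.colorCount i) ∈ Finset.Nat.antidiagonalTuple k m := by
    intro T hT
    rw [mem_filter, mem_K] at hT
    rw [Finset.Nat.mem_antidiagonalTuple]
    have h1 := colorCount_sum k T hT.1.1.2.2.2
    have h2 := List.toFinset_card_of_nodup hT.1.1.1
    rw [← lv, hT.2] at h2
    simp at h2
    omega
  rw [w, U_one, Lpoly, ← sum_fiberwise_of_maps_to hmap (wt k)]
  refine sum_congr rfl fun f _ => ?_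
  have hset : LynSetF (m + 1) k f = ((((K k (Icc 1 (m + 1))).filter
    (fun T => lv T = Icc 1 (m + 1))).filter
      (fun T => (fun i : Fin k => T.colorCount i) = f) : Finset CTree) : Set CTree) := by
    ext T
    rw [mem_LynSetF]
    simp
  rw [hset, Nat.card_coe_set_eq, Set.ncard_coe_finset, ← nsmul_eq_mul, ← sum_const]
  refine sum_congr rfl fun T hT => ?_
  rw [mem_filter] at hT
  rw [wt, ← hT.2]

/-! Bell polynomials -/

theorem coeff_prod_monomial {R : Type*} [CommRing R] (b : ℕ → R) (m : Multiset ℕ) :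
    (m.map fun s => Polynomial.monomial s (b s)).prod =
      Polynomial.monomial m.sum (m.map b).prod := by
  induction m using Multiset.induction with
  | empty => simp
  | cons s m ih => simp [ih, Polynomial.monomial_mul_monomial]

theorem countPerms_eq (m : Multiset ℕ) : (m.countPerms : ℚ) =
    m.card.factorial / (m.toFinset.prod fun s => (m.count s).factorial : ℕ) := by
  have h := Nat.multinomial_spec m.toFinset (fun s => m.count s)
  rw [Multiset.toFinset_sum_count_eq] at h
  have h2 : m.countPerms = Nat.multinomial m.toFinset (fun s => m.count s) := by
    rw [Multiset.countPerms, Finsupp.multinomial_eq]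
    rfl
  rw [h2, ← h, eq_div_iff]
  · push_cast; ring
  · exact_mod_cast (Finset.prod_pos fun s _ => Nat.factorial_pos _).ne'

theorem prod_smul {k : ℕ} (a : ℕ → MvPolynomial (Fin k) ℚ) (m : Multiset ℕ) :
    (m.map fun s => ((s.factorial : ℚ)⁻¹) • a s).prod =
      ((((m.map Nat.factorial).prod : ℕ) : ℚ)⁻¹) • (m.map a).prod := by
  induction m using Multiset.induction with
  | empty => simp
  | cons s m ih =>
    simp only [Multiset.map_cons, Multiset.prod_cons, ih, smul_mul_smul_comm]
    congr 1
    push_cast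
    rw [mul_inv]

theorem coeff_egf_pow {k : ℕ} (a : ℕ → MvPolynomial (Fin k) ℚ) (i j : ℕ) :
    PowerSeries.coeff i (egf a ^ j) = ∑ m ∈ (range (i + 1)).sym j,
      (m.val.countPerms : MvPolynomial (Fin k) ℚ) * if m.val.sum = i then
        (m.val.map fun s => ((s.factorial : ℚ)⁻¹) • a s).prod else 0 := by
  have h1 : PowerSeries.coeff i (egf a ^ j) =
      (PowerSeries.trunc (i + 1) (egf a ^ j)).coeff i := by
    rw [PowerSeries.coeff_trunc, if_pos (by omega)]
  have htr : PowerSeries.trunc (i + 1) (egf a) =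
      ∑ s ∈ range (i + 1), Polynomial.monomial s (PowerSeries.coeff s (egf a)) := by
    ext1 d
    simp [PowerSeries.coeff_trunc, Polynomial.coeff_monomial]
  rw [h1, ← PowerSeries.trunc_trunc_pow, PowerSeries.coeff_trunc, if_pos (by omega),
    ← Polynomial.coe_pow, Polynomial.coeff_coe, htr]
  rw [Finset.sum_pow, Polynomial.finsetSum_coeff]
  refine sum_congr rfl fun m _ => ?_
  rw [Polynomial.coeff_natCast_mul, coeff_prod_monomial, Polynomial.coeff_monomial]
  simp only [egf, PowerSeries.coeff_mk]

theorem bell {k : ℕ} (a : ℕ → MvPolynomial (Fin k) ℚ) (h0 : a 0 = 0) (i j : ℕ) :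
    ∑ᶠ lam ∈ ParSet i j, qcoef i lam • (lam.map a).prod = y a j i := by
  classical
  have hset : ParSet i j = (((((range (i + 1)).sym j).image
      (fun m : Sym ℕ j => m.val)).filter (fun m => m.sum = i ∧ 0 ∉ m) :
        Finset (Multiset ℕ)) : Set (Multiset ℕ)) := by
    ext m
    simp only [ParSet, Set.mem_ofPred_eq, coe_filter, mem_image, mem_sym_iff, mem_range]
    constructor
    · rintro ⟨h1, h2, h3⟩
      refine ⟨⟨⟨m, h2⟩, fun s hs => ?_, rfl⟩, h1, h3⟩
      have := Multiset.le_sum_of_mem (Sym.mem_coe.2 hs)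
      simp at this
      omega
    · rintro ⟨⟨m', h, rfl⟩, h1, h2⟩
      exact ⟨h1, m'.2, h2⟩
  rw [hset, finsum_mem_coe_finset, sum_filter,
    sum_image (g := fun m : Sym ℕ j => m.val) (fun x _ z _ h => Subtype.ext h), y, coeff_egf_pow, smul_sum]
  refine sum_congr rfl fun m _ => ?_
  by_cases h1 : m.val.sum = i
  · by_cases h2 : 0 ∈ m.val
    · have hz : (m.val.map a).prod = 0 := by
        apply Multiset.prod_eq_zero
        rw [Multiset.mem_map]
        exact ⟨0, h2, h0⟩
      rw [if_neg (by tauto), if_pos h1, prod_smul, hz]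
      simp
    · rw [if_pos ⟨h1, h2⟩, if_pos h1, prod_smul]
      rw [show (m.val.countPerms : MvPolynomial (Fin k) ℚ) = C (m.val.countPerms : ℚ) by simp]
      simp only [MvPolynomial.smul_eq_C_mul]
      rw [← mul_assoc, ← mul_assoc, ← C_mul, ← C_mul, countPerms_eq, qcoef, m.2]
      congr 2
      have h3 : (j.factorial : ℚ) ≠ 0 := by positivity
      field_simp
  · rw [if_neg (by tauto), if_neg h1]
    simp

theorem y_of_lt {k : ℕ} (a : ℕ → MvPolynomial (Fin k) ℚ) (h0 : a 0 = 0) (p : ℕ) :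
    ∀ n, n < p → y a p n = 0 := by
  induction p with
  | zero => intro n h; omega
  | succ p ih =>
    intro n h
    cases n with
    | zero => exact y_succ_zero a h0 p
    | succ n =>
      rw [y_succ_succ]
      refine sum_eq_zero fun s _ => ?_
      rw [ih _ (by omega)]
      simp

noncomputable def hh (k s : ℕ) : MvPolynomial (Fin k) ℚ := if s = 0 then 0 else hpoly k (s - 1)

theorem bellL (k i j : ℕ) :
    ∑ᶠ lam ∈ ParSet i j, qcoef i lam • LprodShift k lam = y (w k) j i := by
  rw [← bell _ (w_zero k)]
  refine finsum_mem_congr rfl fun lam hl => ?_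
  rw [LprodShift]
  congr 2
  refine Multiset.map_congr rfl fun s hs => ?_
  have : s ≠ 0 := fun h => hl.2.2 (h ▸ hs)
  rw [Lpoly_eq]
  congr 1
  omega

theorem bellH (k i j : ℕ) :
    ∑ᶠ lam ∈ ParSet i j, qcoef i lam • hprodShift k lam = y (hh k) j i := by
  rw [← bell _ (by simp [hh])]
  refine finsum_mem_congr rfl fun lam hl => ?_
  rw [hprodShift]
  congr 2
  refine Multiset.map_congr rfl fun s hs => ?_
  have : s ≠ 0 := fun h => hl.2.2 (h ▸ hs)
  rw [hh, if_neg this]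

noncomputable def Fs (k : ℕ) : PowerSeries (MvPolynomial (Fin k) ℚ) :=
  -(PowerSeries.rescale (-1) (egf (w k)))

theorem coeff_Fs_pow (k i j : ℕ) : PowerSeries.coeff i (Fs k ^ j) =
    (-1) ^ i * (-1) ^ j * PowerSeries.coeff i (egf (w k) ^ j) := by
  rw [Fs, neg_pow, ← map_pow]
  rw [show ((-1 : PowerSeries (MvPolynomial (Fin k) ℚ)) ^ j) = PowerSeries.C ((-1) ^ j) by simp,
    PowerSeries.coeff_C_mul, PowerSeries.coeff_rescale]
  ring

theorem A_eq (k i j : ℕ) : (-1) ^ (i - j) * y (w k) j i =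
    ((i.factorial : ℚ) / j.factorial) • PowerSeries.coeff i (Fs k ^ j) := by
  rw [coeff_Fs_pow, ← mul_smul_comm, ← y]
  by_cases h : i < j
  · rw [y_of_lt _ (w_zero k) _ _ h]; simp
  · congr 1
    obtain ⟨d, rfl⟩ := Nat.exists_eq_add_of_le (not_lt.1 h)
    rw [Nat.add_sub_cancel_left, pow_add]
    have : ((-1 : MvPolynomial (Fin k) ℚ) ^ j) * (-1) ^ j = 1 := by
      rw [← mul_pow]; simp
    linear_combination (-(-1) ^ d : MvPolynomial (Fin k) ℚ) * this

theorem coeff_Fs_pow_lt (k i j : ℕ) (h : i < j) : PowerSeries.coeff i (Fs k ^ j) = 0 := by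
  have h1 := A_eq k i j
  rw [y_of_lt _ (w_zero k) _ _ h, mul_zero] at h1
  refine (smul_eq_zero.1 h1.symm).resolve_left ?_
  positivity

theorem hasSubst_Fs (k : ℕ) : PowerSeries.HasSubst (Fs k) := by
  apply PowerSeries.HasSubst.of_constantCoeff_zero'
  rw [← PowerSeries.coeff_zero_eq_constantCoeff_apply, Fs, map_neg, PowerSeries.coeff_rescale, egf,
    PowerSeries.coeff_mk, w_zero]
  simp

theorem coeff_subst_Fs (k i N : ℕ) (hN : i < N) (f : PowerSeries (MvPolynomial (Fin k) ℚ)) :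
    PowerSeries.coeff i (f.subst (Fs k)) =
      ∑ d ∈ range N, PowerSeries.coeff d f * PowerSeries.coeff i (Fs k ^ d) := by
  rw [PowerSeries.coeff_subst' (hasSubst_Fs k)]
  simp only [smul_eq_mul]
  apply finsum_eq_sum_of_support_subset
  intro d hd
  rw [Function.mem_support] at hd
  rw [coe_range, Set.mem_Iio]
  by_contra h
  exact hd (by rw [coeff_Fs_pow_lt _ _ _ (by omega), mul_zero])

theorem subst_eq_X (k : ℕ) : (egf (hh k)).subst (Fs k) = PowerSeries.X := by
  ext1 i
  rw [coeff_subst_Fs k i (i + 2) (by omega), sum_range_succ', PowerSeries.coeff_X]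
  have h := rel k i
  have h0 : PowerSeries.coeff 0 (egf (hh k)) = 0 := by simp [egf, hh]
  rw [h0, zero_mul, add_zero]
  have hi : (i.factorial : ℚ) ≠ 0 := by positivity
  apply smul_right_injective _ hi
  simp only [smul_sum]
  have : ∀ p ∈ range (i + 1), (i.factorial : ℚ) • (PowerSeries.coeff (p + 1) (egf (hh k)) *
      PowerSeries.coeff i (Fs k ^ (p + 1))) =
      (-1) ^ (i + 1) * ((-1) ^ p * (H k p 0 * y (w k) (p + 1) i)) := by
    intro p _
    rw [coeff_Fs_pow, y]
    simp only [egf, PowerSeries.coeff_mk, hh, Nat.add_sub_cancel, hpoly_eq]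
    rw [if_neg (by omega)]
    simp only [MvPolynomial.smul_eq_C_mul, div_eq_mul_inv, C_mul]
    ring
  rw [sum_congr rfl this, ← mul_sum, h]
  by_cases h1 : i = 1
  · subst h1; simp
  · simp [h1]

theorem AB (k n : ℕ) (i l : Fin n) :
    ∑ j : Fin n, ((-1) ^ ((i : ℕ) - (j : ℕ)) * y (w k) j i) * y (hh k) l j =
      if i = l then 1 else 0 := by
  have h := coeff_subst_Fs k i n i.2 (egf (hh k) ^ (l : ℕ))
  rw [PowerSeries.subst_pow (hasSubst_Fs k), subst_eq_X, PowerSeries.coeff_X_pow] at h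
  rw [Fin.sum_univ_eq_sum_range
    (fun j => ((-1) ^ ((i : ℕ) - j) * y (w k) j i) * y (hh k) l j) n]
  have : ∀ j ∈ range n, ((-1) ^ ((i : ℕ) - j) * y (w k) j i) * y (hh k) l j =
      (((i : ℕ).factorial : ℚ) / (l : ℕ).factorial) • (PowerSeries.coeff j (egf (hh k) ^ (l : ℕ)) *
        PowerSeries.coeff i (Fs k ^ j)) := by
    intro j _
    rw [A_eq, y, smul_mul_smul_comm, mul_comm (PowerSeries.coeff _ _)]
    congr 1
    have : (j.factorial : ℚ) ≠ 0 := by positivity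
    field_simp
  rw [sum_congr rfl this, ← smul_sum, ← h]
  by_cases hil : i = l
  · subst hil
    have : ((i : ℕ).factorial : ℚ) ≠ 0 := by positivity
    simp [this]
  · rw [if_neg hil, if_neg (fun h => hil (Fin.ext h)), smul_zero]

end LW

/-- The matrices
`A = [(-1)^{i-j} Σ_{λ ⊢ i, ℓ(λ) = j} (i choose λ)(1/m(λ)!) L_{λ∖(1^j)}]_{0 ≤ i,j ≤ n-1}`
and
`B = [Σ_{λ ⊢ i, ℓ(λ) = j} (i choose λ)(1/m(λ)!) h_{λ∖(1^j)}]_{0 ≤ i,j ≤ n-1}`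
over `ℚ[x_1,…,x_k]` are inverses of each other. -/
theorem L_h_whitney_matrices_inverse (n k : ℕ) (hn : 1 ≤ n) (hk : 1 ≤ k) :
    (Matrix.of fun i j : Fin n =>
        (-1 : MvPolynomial (Fin k) ℚ) ^ ((i : ℕ) - (j : ℕ)) *
          ∑ᶠ lam ∈ ParSet (i : ℕ) (j : ℕ), qcoef (i : ℕ) lam • LprodShift k lam) *
      (Matrix.of fun i j : Fin n =>
        ∑ᶠ lam ∈ ParSet (i : ℕ) (j : ℕ), qcoef (i : ℕ) lam • hprodShift k lam) = 1 ∧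
    (Matrix.of fun i j : Fin n =>
        ∑ᶠ lam ∈ ParSet (i : ℕ) (j : ℕ), qcoef (i : ℕ) lam • hprodShift k lam) *
      (Matrix.of fun i j : Fin n =>
        (-1 : MvPolynomial (Fin k) ℚ) ^ ((i : ℕ) - (j : ℕ)) *
          ∑ᶠ lam ∈ ParSet (i : ℕ) (j : ℕ), qcoef (i : ℕ) lam • LprodShift k lam) = 1 := by

  have key : (Matrix.of fun i j : Fin n =>
        (-1 : MvPolynomial (Fin k) ℚ) ^ ((i : ℕ) - (j : ℕ)) *
          ∑ᶠ lam ∈ ParSet (i : ℕ) (j : ℕ), qcoef (i : ℕ) lam • LprodShift k lam) *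
      (Matrix.of fun i j : Fin n =>
        ∑ᶠ lam ∈ ParSet (i : ℕ) (j : ℕ), qcoef (i : ℕ) lam • hprodShift k lam) = 1 := by
    ext1 i l
    rw [Matrix.mul_apply, Matrix.one_apply, ← LW.AB k n i l]
    refine Finset.sum_congr rfl fun j _ => ?_
    simp only [Matrix.of_apply, LW.bellL, LW.bellH]
  exact ⟨key, mul_eq_one_comm.1 key⟩
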